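/- Let L be a Heisenberg Lie algebra H(m) over a field k. Then L is capable (i.e. L ≅ H/Z(H) for some Lie algebra H, where Z(H) is the center of H) if and only if m = 1. -/

import Mathlib

open Module

universe u

section Preliminaries

variable (k : Type u) [Field k]

/-- The product of two Lie rings is a Lie ring with componentwise bracket. -/
instance prodLieRing (A B : Type u) [LieRing A] [LieRing B] : LieRing (A × B) where
  bracket x y := (⁅x.1, y.1⁆, ⁅x.2, y.2⁆)
  add_lie x y z := by ext <;> exact add_lie ..
  lie_add x y z := by ext <;> exact lie_add ..
  lie_self x := by ext <;> exact lie_self _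
  leibniz_lie x y z := by ext <;> exact leibniz_lie ..

/-- The product of two Lie algebras (the external direct sum `A ⊕ B`). -/
instance prodLieAlgebra (A B : Type u) [LieRing A] [LieRing B]
    [LieAlgebra k A] [LieAlgebra k B] : LieAlgebra k (A × B) where
  lie_smul t x y := by ext <;> exact lie_smul ..

/-- `L` is a Heisenberg Lie algebra `H(m)`: it has dimension `2m+1` and its derived
subalgebra `L² = [L,L]` coincides with its centre `Z(L)` and has dimension `1`. -/
def IsHeisenberg (L : Type u) [LieRing L] [LieAlgebra k L] (m : ℕ) : Prop :=
  Module.finrank k L = 2 * m + 1 ∧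
  LieModule.lowerCentralSeries k L L 1 = LieAlgebra.center k L ∧
  Module.finrank k (LieAlgebra.center k L) = 1

/-- The `k`-dimension of the quotient `A / (A ∩ B)` of a submodule `A` by a submodule `B`
(when `B ≤ A` this is the dimension of `A/B`). -/
noncomputable def subQuotRank {V : Type u} [AddCommGroup V] [Module k V]
    (A B : Submodule k V) : Cardinal.{u} :=
  Module.rank k (↥A ⧸ B.comap A.subtype)

/-- The dimension of the 2-nilpotent multiplier `M⁽²⁾(L) = (R ∩ F³)/[[R,F],F]` computed from
the free presentation `π : F ↠ L` (with `F` a free Lie algebra and `R = ker π`). -/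
noncomputable def m2Rank {X L : Type u} [LieRing L] [LieAlgebra k L]
    (π : FreeLieAlgebra k X →ₗ⁅k⁆ L) : Cardinal.{u} :=
  subQuotRank k
    (π.ker ⊓ LieModule.lowerCentralSeries k (FreeLieAlgebra k X) (FreeLieAlgebra k X) 2).toSubmodule
    (⁅(⁅π.ker, (⊤ : LieIdeal k (FreeLieAlgebra k X))⁆ : LieIdeal k (FreeLieAlgebra k X)),
      (⊤ : LieIdeal k (FreeLieAlgebra k X))⁆ : LieIdeal k (FreeLieAlgebra k X)).toSubmodule

/-- A Lie algebra is 2-capable if it is isomorphic to `H/Z₂(H)` for some Lie algebra `H`,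
where `Z₂(H)` is the second term of the upper central series of `H`. -/
def TwoCapable (L : Type u) [LieRing L] [LieAlgebra k L] : Prop :=
  ∃ (H : Type u) (_ : LieRing H) (_ : LieAlgebra k H),
    Nonempty (L ≃ₗ⁅k⁆ H ⧸ LieSubmodule.ucs 2 (⊥ : LieIdeal k H))

/-- A Lie algebra is capable if it is isomorphic to `H/Z(H)` for some Lie algebra `H`. -/
def Capable (L : Type u) [LieRing L] [LieAlgebra k L] : Prop :=
  ∃ (H : Type u) (_ : LieRing H) (_ : LieAlgebra k H),
    Nonempty (L ≃ₗ⁅k⁆ H ⧸ LieAlgebra.center k H)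

end Preliminaries

/-- The four-dimensional filiform algebra. -/
@[ext]
structure Fil (k : Type u) where
  a : k
  b : k
  c : k
  d : k

namespace Fil

variable {k : Type u} [Field k]

def equiv (k : Type u) : Fil k ≃ (k × k × k × k) where
  toFun x := (x.a, x.b, x.c, x.d)
  invFun x := ⟨x.1, x.2.1, x.2.2.1, x.2.2.2⟩

instance : AddCommGroup (Fil k) := (equiv k).addCommGroup

instance : Module k (Fil k) := (equiv k).module k

@[simp] lemma add_a (x y : Fil k) : (x + y).a = x.a + y.a := rfl
@[simp] lemma add_b (x y : Fil k) : (x + y).b = x.b + y.b := rfl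
@[simp] lemma add_c (x y : Fil k) : (x + y).c = x.c + y.c := rfl
@[simp] lemma add_d (x y : Fil k) : (x + y).d = x.d + y.d := rfl
@[simp] lemma zero_a : (0 : Fil k).a = 0 := rfl
@[simp] lemma zero_b : (0 : Fil k).b = 0 := rfl
@[simp] lemma zero_c : (0 : Fil k).c = 0 := rfl
@[simp] lemma zero_d : (0 : Fil k).d = 0 := rfl
@[simp] lemma smul_a (t : k) (x : Fil k) : (t • x).a = t * x.a := rfl
@[simp] lemma smul_b (t : k) (x : Fil k) : (t • x).b = t * x.b := rfl
@[simp] lemma smul_c (t : k) (x : Fil k) : (t • x).c = t * x.c := rfl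
@[simp] lemma smul_d (t : k) (x : Fil k) : (t • x).d = t * x.d := rfl

instance : Bracket (Fil k) (Fil k) where
  bracket x y := ⟨0, 0, x.a * y.b - x.b * y.a, x.a * y.c - x.c * y.a⟩

@[simp] lemma lie_a (x y : Fil k) : ⁅x, y⁆.a = 0 := rfl
@[simp] lemma lie_b (x y : Fil k) : ⁅x, y⁆.b = 0 := rfl
@[simp] lemma lie_c (x y : Fil k) : ⁅x, y⁆.c = x.a * y.b - x.b * y.a := rfl
@[simp] lemma lie_d (x y : Fil k) : ⁅x, y⁆.d = x.a * y.c - x.c * y.a := rfl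

instance : LieRing (Fil k) where
  add_lie x y z := by ext <;> simp <;> ring
  lie_add x y z := by ext <;> simp <;> ring
  lie_self x := by ext <;> simp <;> ring
  leibniz_lie x y z := by ext <;> simp <;> ring

instance : LieAlgebra k (Fil k) where
  lie_smul t x y := by ext <;> simp <;> ring

end Fil

section Heis

variable {k : Type u} [Field k] {L : Type u} [LieRing L] [LieAlgebra k L] {m : ℕ}

lemma IsHeisenberg.fd (hL : IsHeisenberg k L m) : FiniteDimensional k L :=
  FiniteDimensional.of_finrank_pos (by rw [hL.1]; omega)

lemma mem_center' (x : L) : x ∈ LieAlgebra.center k L ↔ ∀ y : L, ⁅x, y⁆ = 0 := by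
  rw [LieModule.mem_maxTrivSubmodule]
  constructor
  · intro h y
    rw [← lie_skew, h y, neg_zero]
  · intro h y
    rw [← lie_skew, h y, neg_zero]

lemma IsHeisenberg.lie_mem (hL : IsHeisenberg k L m) (x y : L) :
    ⁅x, y⁆ ∈ LieAlgebra.center k L := by
  rw [← hL.2.1, LieModule.lowerCentralSeries_succ]
  exact LieSubmodule.lie_mem_lie (LieSubmodule.mem_top x) (by simp)

lemma IsHeisenberg.exists_ne (hL : IsHeisenberg k L m) : ∃ x y : L, ⁅x, y⁆ ≠ 0 := by
  by_contra! h
  have h1 : LieModule.lowerCentralSeries k L L 1 = ⊥ := by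
    rw [LieModule.lowerCentralSeries_succ, LieSubmodule.lie_eq_bot_iff]
    intro x _ y _
    exact h x y
  have h2 := hL.2.2
  rw [← hL.2.1, h1] at h2
  have : Module.finrank k ((⊥ : Submodule k L)) = 1 := h2
  simp at this

lemma IsHeisenberg.exists_smul (hL : IsHeisenberg k L m) {z : L}
    (hz : z ∈ LieAlgebra.center k L) (hz0 : z ≠ 0) {w : L} (hw : w ∈ LieAlgebra.center k L) :
    ∃ t : k, t • z = w := by
  obtain ⟨t, ht⟩ := exists_smul_eq_of_finrank_eq_one hL.2.2
    (x := (⟨z, hz⟩ : LieAlgebra.center k L)) (by simpa [Subtype.ext_iff] using hz0) ⟨w, hw⟩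
  exact ⟨t, congrArg Subtype.val ht⟩

lemma IsHeisenberg.exists_pair (hL : IsHeisenberg k L m) (hm : 2 ≤ m) (x : L) :
    ∃ u v : L, ⁅u, v⁆ ≠ 0 ∧ ⁅u, x⁆ = 0 ∧ ⁅v, x⁆ = 0 := by
  by_cases hx : ∀ y : L, ⁅x, y⁆ = 0
  · obtain ⟨u, v, h⟩ := hL.exists_ne
    exact ⟨u, v, h, by rw [← lie_skew, hx, neg_zero], by rw [← lie_skew, hx, neg_zero]⟩
  push Not at hx
  obtain ⟨y, hy⟩ := hx
  by_contra! hcon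
  have := hL.fd
  let C : Submodule k L := (LieAlgebra.center k L).toSubmodule
  have hC : Module.finrank k C = 1 := hL.2.2
  let A : L → L →ₗ[k] C := fun x => LinearMap.codRestrict C (LieAlgebra.ad k L x)
    (fun w => hL.lie_mem x w)
  let P : L →ₗ[k] C × C := (A x).prod (A y)
  have h1 := P.finrank_range_add_finrank_ker
  have h2 : Module.finrank k (LinearMap.range P) ≤ 2 := by
    refine (Submodule.finrank_le _).trans ?_
    rw [Module.finrank_prod, hC]
  have h3 : LinearMap.ker P ≤ C := by
    intro u hu
    have hu' : A x u = 0 ∧ A y u = 0 := by simpa [P] using hu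
    have hux : ⁅x, u⁆ = 0 := congrArg Subtype.val hu'.1
    have huy : ⁅y, u⁆ = 0 := congrArg Subtype.val hu'.2
    refine (mem_center' (k := k) u).2 fun w => ?_
    obtain ⟨t, ht⟩ := hL.exists_smul (hL.lie_mem x y) hy (hL.lie_mem x w)
    have hw : ⁅w - t • y, x⁆ = 0 := by
      rw [← lie_skew, lie_sub, lie_smul, ht, sub_self, neg_zero]
    have hux' : ⁅u, x⁆ = 0 := by rw [← lie_skew, hux, neg_zero]
    have huy' : ⁅u, y⁆ = 0 := by rw [← lie_skew, huy, neg_zero]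
    by_contra hne
    refine hcon u (w - t • y) ?_ hux' hw
    rwa [lie_sub, lie_smul, huy', smul_zero, sub_zero]
  have h4 := Submodule.finrank_mono h3
  have h5 := hL.1
  omega

lemma IsHeisenberg.not_capable (hL : IsHeisenberg k L m) (hm : 2 ≤ m) : ¬ Capable k L := by
  rintro ⟨H, _, _, ⟨e⟩⟩
  let f : H → L := fun h => e.symm (LieSubmodule.Quotient.mk h)
  have hf0 : ∀ h, f h = 0 → ∀ w : H, ⁅h, w⁆ = 0 := by
    intro h hh
    have h1 : (LieSubmodule.Quotient.mk h : H ⧸ LieAlgebra.center k H) = 0 :=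
      e.symm.injective (hh.trans (map_zero e.symm).symm)
    exact (mem_center' (k := k) h).1 ((LieSubmodule.Quotient.mk_eq_zero').1 h1)
  have hf0' : ∀ h, (∀ w : H, ⁅h, w⁆ = 0) → f h = 0 := by
    intro h hh
    have h1 : (LieSubmodule.Quotient.mk h : H ⧸ LieAlgebra.center k H) = 0 :=
      (LieSubmodule.Quotient.mk_eq_zero').2 ((mem_center' (k := k) h).2 hh)
    change e.symm (LieSubmodule.Quotient.mk h) = 0
    rw [h1, map_zero]
  have hfl : ∀ g h, f ⁅g, h⁆ = ⁅f g, f h⁆ := by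
    intro g h
    change e.symm (LieSubmodule.Quotient.mk ⁅g, h⁆) = _
    rw [LieSubmodule.Quotient.mk_bracket, LieEquiv.map_lie]
  have hfsub : ∀ (t : k) g h, f (t • g - h) = t • f g - f h := by
    intro t g h
    change e.symm (t • LieSubmodule.Quotient.mk g - LieSubmodule.Quotient.mk h) = _
    rw [map_sub, map_smul]
  have hfs : ∀ w, ∃ h, f h = w := by
    intro w
    obtain ⟨h, hh⟩ := LieSubmodule.Quotient.surjective_mk' (LieAlgebra.center k H) (e w)
    refine ⟨h, ?_⟩
    change e.symm (LieSubmodule.Quotient.mk' (LieAlgebra.center k H) h) = w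
    rw [hh, LieEquiv.symm_apply_apply]
  obtain ⟨x, y, hxy⟩ := hL.exists_ne
  obtain ⟨c, hc⟩ := hfs ⁅x, y⁆
  apply hxy
  rw [← hc]
  apply hf0'
  intro w
  obtain ⟨u, v, huv, hu, hv⟩ := hL.exists_pair hm (f w)
  obtain ⟨u, rfl⟩ := hfs u
  obtain ⟨v, rfl⟩ := hfs v
  obtain ⟨t, ht⟩ := hL.exists_smul (hL.lie_mem _ _) huv (hL.lie_mem x y)
  have hd : f (t • ⁅u, v⁆ - c) = 0 := by rw [hfsub, hfl, ht, hc, sub_self]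
  have h1 := hf0 _ hd w
  rw [sub_lie, smul_lie, lie_lie] at h1
  have h2 : ⁅u, ⁅v, w⁆⁆ = 0 := by
    rw [← lie_skew, hf0 _ (by rw [hfl, hv]), neg_zero]
  have h3 : ⁅v, ⁅u, w⁆⁆ = 0 := by
    rw [← lie_skew, hf0 _ (by rw [hfl, hu]), neg_zero]
  rw [h2, h3, sub_zero, smul_zero, zero_sub, neg_eq_zero] at h1
  exact h1

lemma IsHeisenberg.capable (hL : IsHeisenberg k L 1) : Capable k L := by
  obtain ⟨x, y, hz⟩ := hL.exists_ne
  have hc := (mem_center' (k := k) _).1 (hL.lie_mem x y)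
  have hc' : ∀ w, ⁅w, ⁅x, y⁆⁆ = 0 := fun w => by rw [← lie_skew, hc, neg_zero]
  have hyx : ⁅y, x⁆ = - ⁅x, y⁆ := (lie_skew _ _).symm
  generalize hzz : ⁅x, y⁆ = z at *
  have := hL.fd
  let G : k × k × k →ₗ[k] L :=
    { toFun := fun p => p.1 • x + p.2.1 • y + p.2.2 • z
      map_add' := fun p q => by simp only [Prod.fst_add, Prod.snd_add]; module
      map_smul' := fun t p => by simp [mul_smul] }
  have hind : ∀ a b c : k, a • x + b • y + c • z = 0 → a = 0 ∧ b = 0 ∧ c = 0 := by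
    intro a b c h
    have h1 : a = 0 := by
      have := congrArg (fun w => ⁅w, y⁆) h
      simpa [hzz, hc, hz] using this
    have h2 : b = 0 := by
      have := congrArg (fun w => ⁅x, w⁆) h
      simpa [hzz, hc', hz] using this
    subst h1 h2
    simpa [hz] using h
  have hinj : Function.Injective G := by
    rw [← LinearMap.ker_eq_bot, LinearMap.ker_eq_bot']
    rintro ⟨a, b, c⟩ h
    obtain ⟨rfl, rfl, rfl⟩ := hind a b c h
    rfl
  have hsurj : Function.Surjective G := by
    refine (LinearMap.injective_iff_surjective_of_finrank_eq_finrank ?_).1 hinj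
    simp [hL.1]
  let F : Fil k →ₗ⁅k⁆ L :=
    { toFun := fun p => p.a • x + p.b • y + p.c • z
      map_add' := fun p q => by simp only [Fil.add_a, Fil.add_b, Fil.add_c]; module
      map_smul' := fun t p => by simp [mul_smul]
      map_lie' := fun {p q} => by
        simp [hzz, hyx, hc, hc']
        module }
  have hFs : Function.Surjective F := fun w => by
    obtain ⟨⟨a, b, c⟩, h⟩ := hsurj w
    exact ⟨⟨a, b, c, 0⟩, h⟩
  have hker : F.ker = LieAlgebra.center k (Fil k) := by
    ext p
    rw [LieHom.mem_ker, mem_center']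
    constructor
    · intro h q
      obtain ⟨h1, h2, h3⟩ := hind _ _ _ h
      ext <;> simp [h1, h2, h3]
    · intro h
      have h1 := h ⟨1, 0, 0, 0⟩
      have h2 := h ⟨0, 1, 0, 0⟩
      have h1c := congrArg Fil.c h1
      have h1d := congrArg Fil.d h1
      have h2c := congrArg Fil.c h2
      simp at h1c h1d h2c
      change p.a • x + p.b • y + p.c • z = 0
      simp [h1c, h1d, h2c]
  refine ⟨Fil k, inferInstance, inferInstance, ?_⟩
  rw [← hker]
  exact ⟨((F.quotKerEquivRange).trans
    ((LieEquiv.ofEq _ _ (by rw [(LieHom.range_eq_top F).2 hFs])).trans LieSubalgebra.topEquiv)).symm⟩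

end Heis

/-- A Heisenberg Lie algebra `H(m)` is capable if and only if `m = 1`. -/
theorem stmt_14 (k : Type u) [Field k] (L : Type u) [LieRing L] [LieAlgebra k L]
    (m : ℕ) (hL : IsHeisenberg k L m) :
    Capable k L ↔ m = 1 := by
  refine ⟨fun h => ?_, fun h => by subst h; exact hL.capable⟩
  by_contra hm
  rcases Nat.lt_or_ge m 2 with h2 | h2
  · have h0 : m = 0 := by omega
    subst h0
    obtain ⟨x, y, hxy⟩ := hL.exists_ne
    apply hxy
    obtain ⟨t, ht⟩ := exists_smul_eq_of_finrank_eq_one (by simpa using hL.1) hxy x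
    rw [← ht, smul_lie, (mem_center' (k := k) _).1 (hL.lie_mem x y), smul_zero]
  · exact hL.not_capable h2 h
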